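/- arXiv:2308.01181 — 2 statements merged into one kernel-verified Lean document; each statement's English description precedes it below -/
import Mathlib

section
/- Let A be a nonzero polynomial in F_2[x] and let m be a positive integer such that for all k ≥ m one has a_{2k} = b_{2k} = 1 (i.e. x and x+1 each divide A_{2k} exactly once). Then for every k ≥ m, A_{2k+1} = 1 (and hence A_{2k} = x^2 + x). -/
open Polynomial Finset

/-- The polynomial `M = x^2 + x + 1` over `F_2`. -/
noncomputable def M : Polynomial (ZMod 2) := X ^ 2 + X + 1

/-- The odd part of a binary polynomial: `P` divided by `x^{val_x(P)} (x+1)^{val_{x+1}(P)}`. -/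
noncomputable def oddPart (P : Polynomial (ZMod 2)) : Polynomial (ZMod 2) :=
  P / (X ^ P.rootMultiplicity 0 * (X + 1) ^ P.rootMultiplicity 1)

/-- The Collatz sequence of a binary polynomial `A`:
`A_0 = A`, `A_{2k+1} = oddPart A_{2k}`, `A_{2k+2} = 1 + M * A_{2k+1}`. -/
noncomputable def collatz (A : Polynomial (ZMod 2)) : ℕ → Polynomial (ZMod 2)
  | 0 => A
  | n + 1 => if n % 2 = 0 then oddPart (collatz A n) else 1 + M * collatz A n

/-- `a_k`: the multiplicity of `x` in `A_k`. -/
noncomputable def aSeq (A : Polynomial (ZMod 2)) (k : ℕ) : ℕ :=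
  (collatz A k).rootMultiplicity 0

/-- `b_k`: the multiplicity of `x + 1` in `A_k`. -/
noncomputable def bSeq (A : Polynomial (ZMod 2)) (k : ℕ) : ℕ :=
  (collatz A k).rootMultiplicity 1

/-- The length `ℓ_A = m + 1`, where `m` is the least nonnegative integer
with `A_{2m+1} = 1`. -/
noncomputable def collatzLength (A : Polynomial (ZMod 2)) : ℕ :=
  sInf {m : ℕ | collatz A (2 * m + 1) = 1} + 1

theorem X_add_one_dvd_of_rootMultiplicity_one {P : Polynomial (ZMod 2)}
    (h : P.rootMultiplicity 1 = 1) : X + 1 ∣ P := by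
  have h1 := P.pow_rootMultiplicity_dvd 1
  rwa [h, pow_one, CharTwo.sub_eq_add, C_1] at h1

theorem X_dvd_of_rootMultiplicity_zero {P : Polynomial (ZMod 2)}
    (h : P.rootMultiplicity 0 = 1) : X ∣ P := by
  have h0 := P.pow_rootMultiplicity_dvd 0
  rwa [h, pow_one, C_0, sub_zero] at h0

theorem mul_oddPart_of_rootMultiplicity_eq_one {P : Polynomial (ZMod 2)}
    (h0 : P.rootMultiplicity 0 = 1) (h1 : P.rootMultiplicity 1 = 1) :
    (X ^ 2 + X) * oddPart P = P := by
  have hcop : IsCoprime (X : Polynomial (ZMod 2)) (X + 1) := ⟨-1, 1, by ring⟩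
  have hdvd := hcop.mul_dvd (X_dvd_of_rootMultiplicity_zero h0)
    (X_add_one_dvd_of_rootMultiplicity_one h1)
  have hne : (X * (X + 1) : Polynomial (ZMod 2)) ≠ 0 :=
    mul_ne_zero X_ne_zero (X_add_C_ne_zero 1)
  rw [oddPart, h0, h1, pow_one, pow_one, show (X ^ 2 + X : Polynomial (ZMod 2)) = X * (X + 1) by ring]
  exact EuclideanDomain.mul_div_cancel' hne hdvd

theorem collatz_odd (A : Polynomial (ZMod 2)) (k : ℕ) :
    collatz A (2 * k + 1) = oddPart (collatz A (2 * k)) := by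
  simp [collatz]

theorem collatz_even_succ (A : Polynomial (ZMod 2)) (k : ℕ) :
    collatz A (2 * (k + 1)) = 1 + M * collatz A (2 * k + 1) := by
  rw [show 2 * (k + 1) = 2 * k + 1 + 1 by ring, collatz, if_neg (by omega)]

theorem Polynomial.eq_zero_of_forall_pow_dvd {K : Type*} [Field K] {p q : Polynomial K}
    (hp : 0 < p.natDegree) (h : ∀ n : ℕ, p ^ n ∣ q) : q = 0 := by
  by_contra hq
  have hle := natDegree_le_of_dvd (h (q.natDegree + 1)) hq
  rw [natDegree_pow] at hle
  nlinarith

/-- A sequence with `s * d (n + 1) = t * d n`, where `s` is nonconstant and coprime to `t`,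
starts at zero, since `s ^ n` divides `d 0` for every `n`. -/
theorem Polynomial.eq_zero_of_mul_succ_eq_mul {K : Type*} [Field K] {s t : Polynomial K}
    (hs : 0 < s.natDegree) (hst : IsCoprime s t) {d : ℕ → Polynomial K}
    (hd : ∀ n, s * d (n + 1) = t * d n) : d 0 = 0 := by
  have hpow : ∀ n, s ^ n * d n = t ^ n * d 0 := by
    intro n
    induction n with
    | zero => simp
    | succ n ih => rw [pow_succ, mul_assoc, hd, mul_left_comm, ih, pow_succ', mul_assoc]
  exact eq_zero_of_forall_pow_dvd hs fun n ↦
    hst.pow.dvd_of_dvd_mul_left (Dvd.intro _ (hpow n))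

theorem odd_terms_eventually_one (A : Polynomial (ZMod 2)) (hA : A ≠ 0)
    (m : ℕ) (hm : 0 < m)
    (hval : ∀ k ≥ m, aSeq A (2 * k) = 1 ∧ bSeq A (2 * k) = 1) :
    ∀ k ≥ m, collatz A (2 * k + 1) = 1 ∧ collatz A (2 * k) = X ^ 2 + X := by
  intro k hk
  have hfac : ∀ j ≥ m, (X ^ 2 + X) * collatz A (2 * j + 1) = collatz A (2 * j) := by
    intro j hj
    rw [collatz_odd]
    exact mul_oddPart_of_rootMultiplicity_eq_one (hval j hj).1 (hval j hj).2
  have hdeg : 0 < (X ^ 2 + X : Polynomial (ZMod 2)).natDegree := by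
    have : (X ^ 2 + X : Polynomial (ZMod 2)).natDegree = 2 := by compute_degree!
    omega
  have hcop : IsCoprime (X ^ 2 + X) M := ⟨-1, 1, by rw [M]; ring⟩
  have hrec : ∀ n, (X ^ 2 + X) * (collatz A (2 * (k + (n + 1)) + 1) - 1) =
      M * (collatz A (2 * (k + n) + 1) - 1) := by
    intro n
    have h := hfac (k + (n + 1)) (by omega)
    rw [← add_assoc, collatz_even_succ] at h
    rw [← add_assoc, mul_sub, h, M]
    linear_combination CharTwo.two_eq_zero (R := Polynomial (ZMod 2))
  have hone : collatz A (2 * k + 1) = 1 :=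
    sub_eq_zero.mp (Polynomial.eq_zero_of_mul_succ_eq_mul hdeg hcop
      (d := fun n ↦ collatz A (2 * (k + n) + 1) - 1) hrec)
  exact ⟨hone, by rw [← hfac k hk, hone, mul_one]⟩
end

section
/- In F_2[x]: (i) if A = M^{2^r - 1} + ⋯ + M + 1 = Σ_{i=0}^{2^r - 1} M^i with r ≥ 1, then A_1 = 1 and ℓ_A = 1; (ii) if A = M^{2^r - 2k} + ⋯ + M + 1 = Σ_{i=0}^{2^r - 2k} M^i with r > k ≥ 1, then ℓ_A = 2k; (iii) if A = M^{2^r - 2k - 1} + ⋯ + M + 1 = Σ_{i=0}^{2^r - 2k - 1} M^i with r > 2k + 1 ≥ 3, then ℓ_A = 2k + 1. -/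
open Polynomial Finset

/-- A binary polynomial in `x ^ 2 + x` is `X ^ v * B` with `B` odd, up to this substitution;
its odd part is then obtained from `B`. -/
theorem oddPart_X_pow_mul_comp (v : ℕ) {B : (ZMod 2)[X]} (hB : B.coeff 0 = 1) :
    oddPart ((X ^ v * B).comp (X ^ 2 + X)) = B.comp (X ^ 2 + X) := by
  set Q := B.comp (X ^ 2 + X) with hQ
  have h0 : Q.eval 0 = 1 := by simp [hQ, eval_comp, ← coeff_zero_eq_eval_zero, hB]
  have h1 : Q.eval 1 = 1 := by
    have : (1 + 1 : ZMod 2) = 0 := by decide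
    simp [hQ, eval_comp, this, ← coeff_zero_eq_eval_zero, hB]
  have hC0 : Q ≠ 0 := by
    intro h
    simp [h] at h0
  have hneg : (X + 1 : (ZMod 2)[X]) = X - C 1 := by
    rw [CharTwo.sub_eq_add, C_1]
  have hX1 : (X + 1 : (ZMod 2)[X]) ≠ 0 := by
    rw [hneg]; exact X_sub_C_ne_zero 1
  have hfac : (X ^ v * B).comp (X ^ 2 + X) = (X ^ v * (X + 1) ^ v) * Q := by
    rw [mul_comp, X_pow_comp, ← mul_pow]
    congr 2
    ring
  have hXv : (X ^ v : (ZMod 2)[X]) ≠ 0 := pow_ne_zero _ X_ne_zero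
  have hX1v : ((X + 1) ^ v : (ZMod 2)[X]) ≠ 0 := pow_ne_zero _ hX1
  have hne : (X ^ v * (X + 1) ^ v : (ZMod 2)[X]) ≠ 0 := mul_ne_zero hXv hX1v
  have hm0 : ((X ^ v * (X + 1) ^ v) * Q).rootMultiplicity 0 = v := by
    have e1 : (X ^ v : (ZMod 2)[X]) = (X - C 0) ^ v := by simp
    rw [rootMultiplicity_mul (mul_ne_zero hne hC0), rootMultiplicity_mul hne, e1,
      rootMultiplicity_X_sub_C_pow, rootMultiplicity_eq_zero (p := Q) (by simp [IsRoot, h0]),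
      rootMultiplicity_eq_zero (by simp [IsRoot])]
    rfl
  have hm1 : ((X ^ v * (X + 1) ^ v) * Q).rootMultiplicity 1 = v := by
    rw [rootMultiplicity_mul (mul_ne_zero hne hC0), rootMultiplicity_mul hne, hneg,
      rootMultiplicity_X_sub_C_pow, rootMultiplicity_eq_zero (p := Q) (by simp [IsRoot, h1]),
      rootMultiplicity_eq_zero (by simp [IsRoot])]
    omega
  rw [oddPart, hfac, hm0, hm1]
  exact mul_div_cancel_left₀ _ hne

theorem M_eq_comp : M = (1 + X : (ZMod 2)[X]).comp (X ^ 2 + X) := by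
  simp [M]
  ring

theorem collatz_odd_succ (A : (ZMod 2)[X]) (j : ℕ) :
    collatz A (2 * (j + 1) + 1) = oddPart (1 + M * collatz A (2 * j + 1)) := by
  rw [collatz, if_pos (by omega), show 2 * (j + 1) = (2 * j + 1) + 1 by ring, collatz,
    if_neg (by omega)]

/-- Over `ZMod 2`, a nonzero polynomial is a power of `X` times one with constant term `1`. -/
theorem exists_eq_X_pow_mul {G : (ZMod 2)[X]} (hG : G ≠ 0) :
    ∃ (v : ℕ) (B : (ZMod 2)[X]), B.coeff 0 = 1 ∧ G = X ^ v * B := by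
  obtain ⟨B, hB, hnd⟩ := exists_eq_pow_rootMultiplicity_mul_and_not_dvd G hG 0
  rw [C_0, sub_zero] at hB hnd
  rw [X_dvd_iff] at hnd
  exact ⟨_, B, (by decide : ∀ a : ZMod 2, a ≠ 0 → a = 1) _ hnd, hB⟩

theorem coeff_one_add_X_pow_self (e : ℕ) : ((1 + X : (ZMod 2)[X]) ^ e).coeff e = 1 := by
  simp [coeff_one_add_X_pow]

theorem one_add_X_pow_two_pow (s : ℕ) : (1 + X : (ZMod 2)[X]) ^ 2 ^ s = 1 + X ^ 2 ^ s := by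
  rw [add_pow_char_pow, one_pow]

theorem coeff_one_add_X_pow_sub_two_pow {s e : ℕ} (h1 : 2 ^ s ≤ e) (h2 : e < 2 ^ (s + 1)) :
    ((1 + X : (ZMod 2)[X]) ^ e).coeff (e - 2 ^ s) = 1 := by
  obtain ⟨f, rfl⟩ := Nat.exists_eq_add_of_le h1
  have hf : f < 2 ^ s := by rw [pow_succ] at h2; omega
  rw [Nat.add_sub_cancel_left, pow_add, one_add_X_pow_two_pow, add_mul, one_mul, coeff_add,
    coeff_one_add_X_pow_self, coeff_X_pow_mul', if_neg (by omega), add_zero]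

theorem le_of_X_pow_mul_coeff_ne_zero {w i : ℕ} {B : (ZMod 2)[X]}
    (h : (X ^ w * B).coeff i ≠ 0) : w ≤ i := by
  by_contra hlt
  exact h (by rw [coeff_X_pow_mul', if_neg hlt])

/-- The terms of odd index are, up to the substitution of `x ^ 2 + x`, the quotients
`((1 + X) ^ e + P) / X ^ w` with `P` of small degree. -/
structure IsQuotientState (s e w : ℕ) (B P : (ZMod 2)[X]) : Prop where
  coeff_zero_eq_one : B.coeff 0 = 1
  eq : X ^ w * B = (1 + X) ^ e + P
  natDegree_lt : P.natDegree < e - 2 ^ s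
  natDegree_lt' : P.natDegree < w

namespace IsQuotientState

variable {s e w : ℕ} {B P : (ZMod 2)[X]}

theorem le_sub (h : IsQuotientState s e w B P) (he : e < 2 ^ (s + 1)) : w ≤ e - 2 ^ s := by
  apply le_of_X_pow_mul_coeff_ne_zero (B := B)
  have := h.natDegree_lt
  rw [h.eq, coeff_add, coeff_one_add_X_pow_sub_two_pow (by omega) he,
    coeff_eq_zero_of_natDegree_lt h.natDegree_lt]
  simp

theorem ne_one (h : IsQuotientState s e w B P) (he : e < 2 ^ (s + 1)) : B ≠ 1 := by
  rintro rfl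
  have h1 := h.le_sub he
  have h2 := h.natDegree_lt
  have h3 := congrArg (fun p => coeff p e) h.eq
  have h4 : 0 < 2 ^ s := by positivity
  simp only [mul_one, coeff_add, coeff_one_add_X_pow_self, coeff_X_pow] at h3
  rw [coeff_eq_zero_of_natDegree_lt (p := P) (by omega), if_neg (by omega)] at h3
  simp at h3

theorem eq_one (h : IsQuotientState s (2 ^ (s + 1)) w B P) : B = 1 := by
  have hP := h.natDegree_lt
  have hPw := h.natDegree_lt'
  have hw : w ≤ 2 ^ (s + 1) := by
    apply le_of_X_pow_mul_coeff_ne_zero (B := B)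
    rw [h.eq, coeff_add, coeff_one_add_X_pow_self, coeff_eq_zero_of_natDegree_lt (by omega)]
    simp
  obtain ⟨t, ht⟩ := Nat.exists_eq_add_of_le hw
  have heq : X ^ w * B = X ^ w * X ^ t + (1 + P) := by
    rw [h.eq, one_add_X_pow_two_pow, ← pow_add, ← ht]
    ring
  have hdvd : (X : (ZMod 2)[X]) ^ w ∣ 1 + P :=
    (dvd_add_right (Dvd.intro _ rfl)).1 (heq ▸ Dvd.intro _ rfl)
  have hzero : 1 + P = 0 := by
    by_contra hne
    have h1 := natDegree_le_of_dvd hdvd hne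
    have h2 := natDegree_add_le (1 : (ZMod 2)[X]) P
    rw [natDegree_one] at h2
    rw [natDegree_X_pow] at h1
    omega
  rw [hzero, add_zero] at heq
  have hB := mul_left_cancel₀ (pow_ne_zero _ X_ne_zero) heq
  have h0 := h.coeff_zero_eq_one
  rw [hB, coeff_X_pow] at h0
  have : t = 0 := by
    by_contra hne
    rw [if_neg (Ne.symm hne)] at h0
    exact zero_ne_one h0
  rw [hB, this, pow_zero]

theorem step (h : IsQuotientState s e w B P) (he : e < 2 ^ (s + 1)) :
    ∃ v w' B' P', 1 + (1 + X) * B = X ^ v * B' ∧ IsQuotientState s (e + 1) w' B' P' := by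
  have hw := h.le_sub he
  have hP := h.natDegree_lt
  have hPw := h.natDegree_lt'
  have hmul : X ^ w * (1 + (1 + X) * B) = (1 + X) ^ (e + 1) + ((1 + X) * P + X ^ w) := by
    linear_combination (1 + X) * h.eq
  have hdeg : ((1 + X) * P + X ^ w).natDegree ≤ w := by
    refine natDegree_add_le_of_degree_le (natDegree_mul_le.trans ?_) (natDegree_X_pow_le w)
    have : (1 + X : (ZMod 2)[X]).natDegree ≤ 1 := by compute_degree
    omega
  have hG : 1 + (1 + X) * B ≠ 0 := by
    intro h0
    have h3 := congrArg (fun p => coeff p (e + 1)) hmul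
    simp only [h0, mul_zero, coeff_zero] at h3
    rw [coeff_add, coeff_one_add_X_pow_self,
      coeff_eq_zero_of_natDegree_lt (p := (1 + X) * P + X ^ w) (by omega)] at h3
    simp at h3
  obtain ⟨v, B', hB', hv⟩ := exists_eq_X_pow_mul hG
  have hvpos : 0 < v := by
    rw [Nat.pos_iff_ne_zero]
    rintro rfl
    have h0 := congrArg (fun p => coeff p 0) hv
    simp [hB', mul_coeff_zero, h.coeff_zero_eq_one] at h0
  exact ⟨v, w + v, B', _, hv, hB', by rw [pow_add, mul_assoc, ← hv, hmul], by omega, by omega⟩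

end IsQuotientState

theorem sum_M_pow_eq_comp (n : ℕ) :
    ∑ i ∈ Finset.range n, M ^ i =
      (∑ i ∈ Finset.range n, (1 + X : (ZMod 2)[X]) ^ i).comp (X ^ 2 + X) := by
  rw [Polynomial.sum_comp]
  simp only [pow_comp, ← M_eq_comp]

theorem exists_isQuotientState {s n : ℕ} (h1 : 2 ^ s < n) (j : ℕ) (hj : n + j ≤ 2 ^ (s + 1)) :
    ∃ w B P, collatz (∑ i ∈ Finset.range n, M ^ i) (2 * j + 1) = B.comp (X ^ 2 + X) ∧
      IsQuotientState s (n + j) w B P := by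
  induction j with
  | zero =>
    have hgeom : X * ∑ i ∈ Finset.range n, (1 + X : (ZMod 2)[X]) ^ i = (1 + X) ^ n + 1 := by
      have := mul_geom_sum (1 + X : (ZMod 2)[X]) n
      rwa [add_sub_cancel_left, CharTwo.sub_eq_add] at this
    have hne : ∑ i ∈ Finset.range n, (1 + X : (ZMod 2)[X]) ^ i ≠ 0 := by
      intro h0
      have h3 := congrArg (fun p => coeff p n) hgeom
      simp only [h0, mul_zero, coeff_zero] at h3
      rw [coeff_add, coeff_one_add_X_pow_self, coeff_one, if_neg (by omega)] at h3
      simp at h3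
    obtain ⟨v, B, hB, hv⟩ := exists_eq_X_pow_mul hne
    refine ⟨v + 1, B, 1, ?_, hB, ?_, ?_, ?_⟩
    · rw [collatz, if_pos (by omega), mul_zero, collatz, sum_M_pow_eq_comp, hv,
        oddPart_X_pow_mul_comp v hB]
    · rw [pow_succ', mul_assoc, ← hv, hgeom, add_zero]
    · rw [natDegree_one]; omega
    · rw [natDegree_one]; omega
  | succ j ih =>
    obtain ⟨w, B, P, hc, hst⟩ := ih (by omega)
    obtain ⟨v, w', B', P', hv, hst'⟩ := hst.step (by omega)
    refine ⟨w', B', P', ?_, hst'⟩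
    rw [collatz_odd_succ, hc, M_eq_comp, ← mul_comp, ← oddPart_X_pow_mul_comp v hst'.coeff_zero_eq_one,
      ← hv, add_comp, one_comp]

theorem comp_X_sq_add_X_eq_one {B : (ZMod 2)[X]} (h : B.comp (X ^ 2 + X) = 1) : B = 1 := by
  have hdeg : (X ^ 2 + X : (ZMod 2)[X]).natDegree = 2 := by compute_degree!
  have h1 := congrArg natDegree h
  rw [natDegree_comp, hdeg, natDegree_one] at h1
  rwa [eq_C_of_natDegree_eq_zero (p := B) (by omega), C_comp,
    ← eq_C_of_natDegree_eq_zero (by omega)] at h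

theorem collatz_geom_sum_eq_one_iff {s n : ℕ} (h1 : 2 ^ s < n) (j : ℕ)
    (hj : n + j ≤ 2 ^ (s + 1)) :
    collatz (∑ i ∈ Finset.range n, M ^ i) (2 * j + 1) = 1 ↔ n + j = 2 ^ (s + 1) := by
  obtain ⟨w, B, P, hc, hst⟩ := exists_isQuotientState h1 j hj
  rw [hc]
  constructor
  · intro h
    by_contra hne
    exact hst.ne_one (by omega) (comp_X_sq_add_X_eq_one h)
  · intro h
    rw [h] at hst
    rw [hst.eq_one, one_comp]

/-- For `2 ^ s < n ≤ 2 ^ (s + 1)`, the geometric sum of length `n` has length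
`2 ^ (s + 1) - n + 1`. -/
theorem collatzLength_geom_sum {s n : ℕ} (h1 : 2 ^ s < n) (h2 : n ≤ 2 ^ (s + 1)) :
    collatzLength (∑ i ∈ Finset.range n, M ^ i) = 2 ^ (s + 1) - n + 1 := by
  have hleast : IsLeast {m : ℕ | collatz (∑ i ∈ Finset.range n, M ^ i) (2 * m + 1) = 1}
      (2 ^ (s + 1) - n) := by
    refine ⟨(collatz_geom_sum_eq_one_iff h1 _ (by omega)).2 (by omega), fun m hm => ?_⟩
    by_contra hlt
    have := (collatz_geom_sum_eq_one_iff h1 m (by omega)).1 hm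
    omega
  rw [collatzLength, hleast.csInf_eq]

theorem length_geom_sums :
    (∀ r : ℕ, 1 ≤ r →
      collatz (∑ i ∈ Finset.range (2 ^ r), M ^ i) 1 = 1 ∧
      collatzLength (∑ i ∈ Finset.range (2 ^ r), M ^ i) = 1) ∧
    (∀ r k : ℕ, 1 ≤ k → k < r →
      collatzLength (∑ i ∈ Finset.range (2 ^ r - 2 * k + 1), M ^ i) = 2 * k) ∧
    (∀ r k : ℕ, 1 ≤ k → 2 * k + 1 < r →
      collatzLength (∑ i ∈ Finset.range (2 ^ r - (2 * k + 1) + 1), M ^ i)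
        = 2 * k + 1) := by
  refine ⟨fun r hr => ?_, fun r k hk hr => ?_, fun r k hk hr => ?_⟩
  · obtain ⟨s, rfl⟩ := Nat.exists_eq_add_of_le' hr
    have hs : 2 ^ s < 2 ^ (s + 1) := Nat.pow_lt_pow_right one_lt_two s.lt_succ_self
    refine ⟨(collatz_geom_sum_eq_one_iff hs 0 le_rfl).2 rfl, ?_⟩
    rw [collatzLength_geom_sum hs le_rfl, Nat.sub_self]
  · obtain ⟨s, rfl⟩ := Nat.exists_eq_add_of_le' (hk.trans hr.le)
    obtain ⟨t, rfl⟩ := Nat.exists_eq_add_of_le' (hk.trans (Nat.lt_succ_iff.1 hr))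
    have ht : t < 2 ^ t := Nat.lt_two_pow_self
    have hk2 : k ≤ 2 ^ t := by omega
    have h1 : 2 ^ (t + 1) = 2 * 2 ^ t := pow_succ' ..
    have h2 : 2 ^ (t + 1 + 1) = 2 * 2 ^ (t + 1) := pow_succ' ..
    rw [collatzLength_geom_sum (s := t + 1) (by omega) (by omega)]
    omega
  · obtain ⟨s, rfl⟩ := Nat.exists_eq_add_of_le' (show 1 ≤ r by omega)
    have hs : s < 2 ^ s := Nat.lt_two_pow_self
    have h1 : 2 ^ (s + 1) = 2 * 2 ^ s := pow_succ' ..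
    rw [collatzLength_geom_sum (s := s) (by omega) (by omega)]
    omega
end
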